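/- For all nonempty finite vertex sets K ⊆ L ⊆ V and every y ∈ V: Σ_{x∈L} harm_L(x) · P_x[τ_K < ∞ and X_{τ_K} = y] = harm_K(y) · cap(K)/cap(L); equivalently, the entrance distribution in K of the chain started from harm_L, conditioned to hit K, is harm_K. -/

import Mathlib

open MeasureTheory Filter

section Setup

variable {V : Type*} [MeasurableSpace V]

/-- Total weight at a vertex: `a_x = Σ_{z∼x} a_{x,z}`. -/
noncomputable def aTot (G : SimpleGraph V) [G.LocallyFinite] (a : V → V → ℝ) (x : V) : ℝ :=
  ∑ z ∈ G.neighborFinset x, a x z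

open Classical in
/-- Transition probabilities of the weighted random walk:
`p(x,y) = a_{x,y}/a_x` for edges and `0` otherwise. -/
noncomputable def step (G : SimpleGraph V) [G.LocallyFinite] (a : V → V → ℝ) (x y : V) : ℝ :=
  if G.Adj x y then a x y / aTot G a x else 0

/-- The event `{τ_K^+ = ∞}`: the walk never returns to `K` at a time `n ≥ 1`. -/
def noReturn (K : Set V) : Set (ℕ → V) := {w | ∀ n ≥ 1, w n ∉ K}

/-- The event `{τ_K < ∞}`: the walk hits `K`. -/
def hits (K : Set V) : Set (ℕ → V) := {w | ∃ n, w n ∈ K}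

/-- The event `{τ_K < ∞ and X_{τ_K} = y}`: the walk hits `K`, entering it at `y`. -/
def hitsAt (K : Set V) (y : V) : Set (ℕ → V) :=
  {w | (∃ n, w n ∈ K) ∧ w (sInf {n | w n ∈ K}) = y}

/-- The event `{λ_K < ∞ and X_{λ_K} = y}`: the walk visits `K`, finitely often,
and its last visit to `K` is at `y`. -/
def lastVisitAt (K : Set V) (y : V) : Set (ℕ → V) :=
  {w | (∃ n, w n ∈ K) ∧ {n | w n ∈ K}.Finite ∧ w (sSup {n | w n ∈ K}) = y}

open Classical in
/-- The equilibrium measure of a finite vertex set `K`: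
`e_K(x) = a_x · P_x[τ_K^+ = ∞]` for `x ∈ K`, and `0` otherwise. -/
noncomputable def equil (G : SimpleGraph V) [G.LocallyFinite] (a : V → V → ℝ)
    (P : V → Measure (ℕ → V)) (K : Finset V) (x : V) : ℝ :=
  if x ∈ K then aTot G a x * ((P x) (noReturn (K : Set V))).toReal else 0

/-- The capacity of a finite vertex set `K`: `cap(K) = Σ_{x∈K} e_K(x)`. -/
noncomputable def capa (G : SimpleGraph V) [G.LocallyFinite] (a : V → V → ℝ)
    (P : V → Measure (ℕ → V)) (K : Finset V) : ℝ :=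
  ∑ x ∈ K, equil G a P K x

/-- The harmonic measure of a nonempty finite vertex set `K`: `harm_K = e_K / cap(K)`. -/
noncomputable def harm (G : SimpleGraph V) [G.LocallyFinite] (a : V → V → ℝ)
    (P : V → Measure (ℕ → V)) (K : Finset V) (x : V) : ℝ :=
  equil G a P K x / capa G a P K

end Setup

section PathSpace

variable {V : Type*}

/-- The cylinder of paths agreeing with `c` up to time `n`. -/
def pathCylinder (n : ℕ) (c : ℕ → V) : Set (ℕ → V) := {w | ∀ i ≤ n, w i = c i}

/-- The shift on path space. -/
def pathShift (w : ℕ → V) : ℕ → V := fun i => w (i + 1)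

/-- The paths that are at `y` at time `n` and avoid `K` strictly before. -/
def firstEntrance (K : Set V) (n : ℕ) (y : V) : Set (ℕ → V) :=
  {w | w n = y ∧ ∀ i < n, w i ∉ K}

/-- The paths that are at `x` at time `n`, avoid `K` at the times `1, …, n` and avoid `L`
afterwards. -/
def lastExit (K L : Set V) (n : ℕ) (x : V) : Set (ℕ → V) :=
  {w | (∀ i < n, w (i + 1) ∉ K) ∧ w n = x ∧ ∀ m > n, w m ∉ L}

theorem isPiSystem_pathCylinder :
    IsPiSystem {s : Set (ℕ → V) | ∃ n c, s = pathCylinder n c} := by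
  have key : ∀ (n m : ℕ) (c d : ℕ → V), n ≤ m → (pathCylinder n c ∩ pathCylinder m d).Nonempty →
      pathCylinder n c ∩ pathCylinder m d = pathCylinder m d := by
    rintro n m c d h ⟨w, hw, hw'⟩
    refine Set.inter_eq_right.2 fun v hv i hi => ?_
    rw [hv i (hi.trans h), ← hw' i (hi.trans h), hw i hi]
  rintro _ ⟨n, c, rfl⟩ _ ⟨m, d, rfl⟩ hne
  rcases le_total n m with h | h
  · exact ⟨m, d, key n m c d h hne⟩
  · rw [Set.inter_comm] at hne ⊢
    exact ⟨n, c, key m n d c h hne⟩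

theorem hitsAt_eq_iUnion_firstEntrance {K : Set V} {y : V} (hy : y ∈ K) :
    hitsAt K y = ⋃ n, firstEntrance K n y := by
  ext w
  simp only [Set.mem_iUnion]
  constructor
  · rintro ⟨-, h⟩
    exact ⟨_, h, fun i hi => Nat.notMem_of_lt_sInf hi⟩
  · rintro ⟨n, hn, h⟩
    have hnK : w n ∈ K := hn ▸ hy
    have : sInf {n | w n ∈ K} = n :=
      le_antisymm (Nat.sInf_le hnK) (not_lt.1 fun hlt => h _ hlt
        (Nat.sInf_mem (s := {n | w n ∈ K}) ⟨n, hnK⟩))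
    exact ⟨⟨n, hnK⟩, this ▸ hn⟩

variable [MeasurableSpace V]

theorem measurable_pathShift : Measurable (pathShift : (ℕ → V) → ℕ → V) :=
  measurable_pi_lambda _ fun i => measurable_pi_apply (i + 1)

variable [DiscreteMeasurableSpace V]

theorem measurableSet_eval_mem (n : ℕ) (s : Set V) : MeasurableSet {w : ℕ → V | w n ∈ s} :=
  measurable_pi_apply n (MeasurableSet.of_discrete (s := s))

theorem measurableSet_pathCylinder (n : ℕ) (c : ℕ → V) : MeasurableSet (pathCylinder n c) := by
  have : pathCylinder n c = ⋂ i, ⋂ (_ : i ≤ n), {w : ℕ → V | w i ∈ ({c i} : Set V)} := by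
    ext w; simp [pathCylinder]
  rw [this]
  exact MeasurableSet.iInter fun i => MeasurableSet.iInter fun _ => measurableSet_eval_mem _ _

theorem measurableSet_firstEntrance (K : Set V) (n : ℕ) (y : V) :
    MeasurableSet (firstEntrance K n y) := by
  have : firstEntrance K n y = {w : ℕ → V | w n ∈ ({y} : Set V)} ∩
      ⋂ i, ⋂ (_ : i < n), {w : ℕ → V | w i ∈ Kᶜ} := by
    ext w; simp [firstEntrance]
  rw [this]
  exact (measurableSet_eval_mem _ _).inter
    (MeasurableSet.iInter fun i => MeasurableSet.iInter fun _ => measurableSet_eval_mem _ _)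

theorem measurableSet_lastExit (K L : Set V) (n : ℕ) (x : V) :
    MeasurableSet (lastExit K L n x) := by
  have : lastExit K L n x = (⋂ i, ⋂ (_ : i < n), {w : ℕ → V | w (i + 1) ∈ Kᶜ}) ∩
      ({w : ℕ → V | w n ∈ ({x} : Set V)} ∩
      ⋂ m, ⋂ (_ : n < m), {w : ℕ → V | w m ∈ Lᶜ}) := by
    ext w; simp [lastExit]
  rw [this]
  exact (MeasurableSet.iInter fun i => MeasurableSet.iInter fun _ =>
    measurableSet_eval_mem _ _).inter ((measurableSet_eval_mem _ _).inter
    (MeasurableSet.iInter fun i => MeasurableSet.iInter fun _ => measurableSet_eval_mem _ _))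

theorem measure_hitsAt {K : Set V} {y : V} (hy : y ∈ K) (μ : Measure (ℕ → V)) :
    μ (hitsAt K y) = ∑' n, μ (firstEntrance K n y) := by
  rw [hitsAt_eq_iUnion_firstEntrance hy,
    measure_iUnion _ fun n => measurableSet_firstEntrance K n y]
  have key : ∀ m n (w : ℕ → V), w ∈ firstEntrance K m y → w ∈ firstEntrance K n y → ¬ m < n :=
    fun m n w hm hn hlt => hn.2 m hlt (hm.1 ▸ hy)
  intro m n hmn
  refine Set.disjoint_left.2 fun w hm hn => ?_
  rcases lt_or_gt_of_ne hmn with h | h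
  · exact key m n w hm hn h
  · exact key n m w hn hm h

variable [Countable V]

theorem generateFrom_pathCylinder :
    (inferInstance : MeasurableSpace (ℕ → V)) =
      MeasurableSpace.generateFrom {s : Set (ℕ → V) | ∃ n c, s = pathCylinder n c} := by
  apply le_antisymm
  · refine iSup_le fun n => ?_
    rintro _ ⟨s, -, rfl⟩
    have : (fun w : ℕ → V => w n) ⁻¹' s =
        ⋃ (c : Fin (n + 1) → V) (_ : c (Fin.last n) ∈ s),
          pathCylinder n (fun i => c (Fin.ofNat (n + 1) i)) := by
      ext w
      simp only [Set.mem_preimage, Set.mem_iUnion, exists_prop]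
      constructor
      · intro h
        refine ⟨fun i => w i, by simpa using h, fun i hi => ?_⟩
        simp [Fin.ofNat, Nat.mod_eq_of_lt (Nat.lt_succ_of_le hi)]
      · rintro ⟨c, hc, hw⟩
        have := hw n le_rfl
        rw [this]
        convert hc
        simp [Fin.ext_iff, Fin.ofNat]
    rw [this]
    exact MeasurableSet.iUnion fun c => MeasurableSet.iUnion fun _ =>
      MeasurableSpace.measurableSet_generateFrom ⟨n, _, rfl⟩
  · refine MeasurableSpace.generateFrom_le ?_
    rintro _ ⟨n, c, rfl⟩
    exact measurableSet_pathCylinder n c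

end PathSpace

section Chain

variable {V : Type*} [MeasurableSpace V] [DiscreteMeasurableSpace V]
  {p : V → V → ENNReal} {P : V → Measure (ℕ → V)}

open Classical in
/-- `P` is the family of laws of the Markov chain with transition matrix `p`. -/
def IsChainLaw (p : V → V → ENNReal) (P : V → Measure (ℕ → V)) : Prop :=
  ∀ (x : V) (n : ℕ) (c : ℕ → V), P x (pathCylinder n c) =
    (if c 0 = x then 1 else 0) * ∏ i ∈ Finset.range n, p (c i) (c (i + 1))

variable [∀ x, IsProbabilityMeasure (P x)]

theorem IsChainLaw.ae_start (hP : IsChainLaw p P) (x : V) : ∀ᵐ w ∂P x, w 0 = x := by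
  have h := hP x 0 fun _ => x
  have h' : pathCylinder 0 (fun _ => x) = {w : ℕ → V | w 0 = x} := by
    ext w; simp [pathCylinder]
  simp only [if_true, Finset.range_zero, Finset.prod_empty, mul_one] at h
  have hc := (prob_compl_eq_zero_iff (measurableSet_pathCylinder 0 fun _ => x)).2 h
  rwa [h'] at hc

open Classical in
theorem IsChainLaw.firstEntrance_zero (hP : IsChainLaw p P) (K : Set V) (x y : V) :
    P x (firstEntrance K 0 y) = if x = y then 1 else 0 := by
  have h : P x (firstEntrance K 0 y) = P x {_w | x = y} := by
    refine measure_congr ?_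
    filter_upwards [hP.ae_start x] with w hw
    refine propext ⟨fun h => hw.symm.trans h.1, fun h => ⟨hw.trans h, by simp⟩⟩
  rw [h]
  split_ifs with hxy <;> simp [hxy]

theorem IsChainLaw.lastExit_zero (hP : IsChainLaw p P) (K L : Set V) (y x : V) :
    P y (lastExit K L 0 x) = P y (firstEntrance K 0 x) * P x (noReturn L) := by
  classical
  rw [hP.firstEntrance_zero]
  have h : P y (lastExit K L 0 x) = P y ({_w | y = x} ∩ noReturn L) := by
    refine measure_congr ?_
    filter_upwards [hP.ae_start y] with w hw
    refine propext ⟨fun h => ⟨hw.symm.trans h.2.1, fun m hm => h.2.2 m hm⟩,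
      fun h => ⟨by simp, hw.trans h.1, fun m hm => h.2 m hm⟩⟩
  rw [h]
  split_ifs with hxy
  · simp [hxy]
  · simp [hxy]

/-- Last-exit decomposition of the event of not returning to `K`. -/
theorem IsChainLaw.noReturn_eq_sum (hP : IsChainLaw p P) {K L : Finset V} (hKL : K ⊆ L)
    {y : V} (hy : y ∈ K) (htrans : ∀ x : V, ∀ᵐ w ∂P y, {n : ℕ | w n = x}.Finite) :
    P y (noReturn (K : Set V)) = ∑ x ∈ L, ∑' n, P y (lastExit (K : Set V) L n x) := by
  have hU : P y (noReturn (K : Set V)) =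
      P y (⋃ q : L × ℕ, lastExit (K : Set V) L q.2 q.1) := by
    refine measure_congr ?_
    filter_upwards [hP.ae_start y, (eventually_all_finset L).2 fun x _ => htrans x]
      with w hw hfin
    have hfinL : {n | w n ∈ L}.Finite := by
      have : {n | w n ∈ L} = ⋃ x ∈ L, {n | w n = x} := by ext n; simp
      rw [this]
      exact L.finite_toSet.biUnion fun x hx => hfin x hx
    refine propext ⟨fun h => ?_, fun h => ?_⟩
    · obtain ⟨n, hn, hmax⟩ := hfinL.exists_maximal ⟨0, by simpa [hw] using hKL hy⟩
      refine Set.mem_iUnion.2 ⟨(⟨w n, hn⟩, n), fun i _ => h (i + 1) (by omega), rfl, ?_⟩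
      exact fun m hm hmL => absurd (hmax hmL hm.le) (not_le.2 hm)
    · obtain ⟨⟨x, n⟩, h1, h2, h3⟩ := Set.mem_iUnion.1 h
      intro m hm
      rcases lt_or_ge n m with hnm | hnm
      · exact fun hmK => h3 m hnm (hKL hmK)
      · obtain ⟨i, rfl⟩ : ∃ i, m = i + 1 := ⟨m - 1, by omega⟩
        exact h1 i hnm
  rw [hU, measure_iUnion _ fun q => measurableSet_lastExit _ _ _ _,
    ENNReal.tsum_prod (f := fun (x : L) n => P y (lastExit (K : Set V) L n x)),
    tsum_fintype, Finset.sum_coe_sort L fun x => ∑' n, P y (lastExit (K : Set V) L n x)]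
  have key : ∀ (q r : L × ℕ) (w : ℕ → V), w ∈ lastExit (K : Set V) L q.2 q.1 →
      w ∈ lastExit (K : Set V) L r.2 r.1 → ¬ q.2 < r.2 := by
    intro q r w hq hr hlt
    exact hq.2.2 _ hlt (hr.2.1 ▸ r.1.2)
  intro q r hqr
  refine Set.disjoint_left.2 fun w hq hr => hqr ?_
  have h2 : q.2 = r.2 := le_antisymm (not_lt.1 (key r q w hr hq)) (not_lt.1 (key q r w hq hr))
  refine Prod.ext (Subtype.ext ?_) h2
  rw [← hq.2.1, ← hr.2.1, h2]

variable [Countable V]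

/-- The Markov property at time one. -/
theorem IsChainLaw.map_shift (hP : IsChainLaw p P) (x : V) :
    (P x).map pathShift = Measure.sum fun z => p x z • P z := by
  classical
  have hcyl : ∀ (n : ℕ) (d : ℕ → V), (P x).map pathShift (pathCylinder n d) =
      (Measure.sum fun z => p x z • P z) (pathCylinder n d) := by
    intro n d
    rw [Measure.map_apply measurable_pathShift (measurableSet_pathCylinder n d),
      Measure.sum_apply _ (measurableSet_pathCylinder n d)]
    have h1 : P x (pathShift ⁻¹' pathCylinder n d) =
        P x (pathCylinder (n + 1) fun i => Nat.casesOn i x d) := by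
      refine measure_congr ?_
      filter_upwards [hP.ae_start x] with w hw
      refine propext ⟨fun h i hi => ?_, fun h i hi => h (i + 1) (by omega)⟩
      cases i with
      | zero => exact hw
      | succ i => exact h i (by omega)
    rw [h1, hP, tsum_eq_single (d 0), Finset.prod_range_succ']
    · simp [hP (d 0) n d, mul_comm]
    · intro z hz
      simp [hP z n d, hz.symm]
  refine Measure.ext_of_generateFrom_of_cover_subset generateFrom_pathCylinder
    isPiSystem_pathCylinder (T := Set.range fun v : V => pathCylinder 0 fun _ => v)
    ?_ (Set.countable_range _) ?_ ?_ ?_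
  · rintro _ ⟨v, rfl⟩
    exact ⟨0, _, rfl⟩
  · refine Set.eq_univ_of_forall fun w => ⟨_, ⟨w 0, rfl⟩, fun i hi => ?_⟩
    rw [Nat.le_zero.1 hi]
  · rintro _ ⟨v, rfl⟩
    rw [Measure.map_apply measurable_pathShift (measurableSet_pathCylinder _ _)]
    exact measure_ne_top _ _
  · rintro _ ⟨n, c, rfl⟩
    exact hcyl n c

theorem IsChainLaw.apply_preimage_shift (hP : IsChainLaw p P) (x : V) {B : Set (ℕ → V)}
    (hB : MeasurableSet B) : P x (pathShift ⁻¹' B) = ∑' z, p x z * P z B := by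
  rw [← Measure.map_apply measurable_pathShift hB, hP.map_shift, Measure.sum_apply _ hB]
  rfl

open Classical in
theorem IsChainLaw.firstEntrance_succ (hP : IsChainLaw p P) (K : Set V) (n : ℕ) (x y : V) :
    P x (firstEntrance K (n + 1) y) =
      if x ∈ K then 0 else ∑' z, p x z * P z (firstEntrance K n y) := by
  have h : P x (firstEntrance K (n + 1) y) =
      P x ({_w | x ∉ K} ∩ pathShift ⁻¹' firstEntrance K n y) := by
    refine measure_congr ?_
    filter_upwards [hP.ae_start x] with w hw
    refine propext ⟨fun h => ⟨?_, h.1, fun i hi => h.2 (i + 1) (by omega)⟩,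
      fun h => ⟨h.2.1, fun i hi => ?_⟩⟩
    · have := h.2 0 (by omega)
      rwa [hw] at this
    · cases i with
      | zero => rw [hw]; exact h.1
      | succ i => exact h.2.2 i (by omega)
  rw [h, ← hP.apply_preimage_shift x (measurableSet_firstEntrance K n y)]
  split_ifs with hx <;> simp [hx]

open Classical in
/-- Decomposition of a first entrance according to the last position before it. -/
theorem IsChainLaw.firstEntrance_succ' (hP : IsChainLaw p P) (K : Set V) (n : ℕ) (x y : V) :
    P x (firstEntrance K (n + 1) y) =
      ∑' z, P x (firstEntrance K n z) * if z ∈ K then 0 else p z y := by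
  induction n generalizing x with
  | zero =>
    rw [hP.firstEntrance_succ, tsum_eq_single y, tsum_eq_single x]
    · simp [hP.firstEntrance_zero]
    · intro z hz
      simp [hP.firstEntrance_zero, hz.symm]
    · intro z hz
      simp [hP.firstEntrance_zero, hz]
  | succ n ih =>
    rw [hP.firstEntrance_succ]
    simp_rw [hP.firstEntrance_succ K n x]
    split_ifs with hx
    · simp
    · simp_rw [ih, ← ENNReal.tsum_mul_left, ← ENNReal.tsum_mul_right]
      rw [ENNReal.tsum_comm]
      simp_rw [mul_assoc]

open Classical in
theorem IsChainLaw.lastExit_succ (hP : IsChainLaw p P) (K L : Set V) (n : ℕ) (y x : V) :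
    P y (lastExit K L (n + 1) x) =
      ∑' z, p y z * if z ∈ K then 0 else P z (lastExit K L n x) := by
  have h : lastExit K L (n + 1) x =
      pathShift ⁻¹' ({w | w 0 ∈ Kᶜ} ∩ lastExit K L n x) := by
    ext w
    constructor
    · rintro ⟨h1, h2, h3⟩
      exact ⟨h1 0 (by omega), fun i hi => h1 (i + 1) (by omega), h2,
        fun m hm => h3 (m + 1) (by omega)⟩
    · rintro ⟨h0, h1, h2, h3⟩
      refine ⟨fun i hi => ?_, h2, fun m hm => ?_⟩
      · cases i with
        | zero => exact h0
        | succ i => exact h1 i (by omega)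
      · cases m with
        | zero => omega
        | succ m => exact h3 m (by omega)
  rw [h, hP.apply_preimage_shift y
    ((measurableSet_eval_mem 0 _).inter (measurableSet_lastExit K L n x))]
  refine tsum_congr fun z => ?_
  congr 1
  have h' : P z ({w | w 0 ∈ Kᶜ} ∩ lastExit K L n x) = P z ({_w | z ∉ K} ∩ lastExit K L n x) := by
    refine measure_congr ?_
    filter_upwards [hP.ae_start z] with w hw
    refine propext (and_congr_left fun _ => ?_)
    change w 0 ∉ K ↔ z ∉ K
    rw [hw]
  rw [h']
  split_ifs with hz <;> simp [hz]

/-- Time reversal of a reversible chain, between a visit to `y` and the last exit from `L`. -/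
theorem IsChainLaw.reversal (hP : IsChainLaw p P) {b : V → ENNReal}
    (hb : ∀ x y, b x * p x y = b y * p y x) (K L : Set V) (n : ℕ) (y x : V) :
    b y * P y (lastExit K L n x) = b x * P x (firstEntrance K n y) * P x (noReturn L) := by
  classical
  induction n generalizing y with
  | zero =>
    rw [hP.lastExit_zero, hP.firstEntrance_zero, hP.firstEntrance_zero]
    by_cases h : y = x
    · simp [h]
    · simp [h, Ne.symm h]
  | succ n ih =>
    rw [hP.lastExit_succ, hP.firstEntrance_succ', ← ENNReal.tsum_mul_left,
      ← ENNReal.tsum_mul_left, ← ENNReal.tsum_mul_right]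
    refine tsum_congr fun z => ?_
    split_ifs with hz
    · simp
    · rw [← mul_assoc, hb y z, mul_right_comm, ih z]
      ring

/-- Sweeping identity: the equilibrium measure of `L` is swept onto that of `K`. -/
theorem IsChainLaw.sweeping (hP : IsChainLaw p P) {b : V → ENNReal}
    (hb : ∀ x y, b x * p x y = b y * p y x) {K L : Finset V} (hKL : K ⊆ L)
    {y : V} (hy : y ∈ K) (htrans : ∀ x : V, ∀ᵐ w ∂P y, {n : ℕ | w n = x}.Finite) :
    ∑ x ∈ L, b x * P x (noReturn (L : Set V)) * P x (hitsAt (K : Set V) y) =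
      b y * P y (noReturn (K : Set V)) := by
  rw [hP.noReturn_eq_sum hKL hy htrans, Finset.mul_sum]
  refine Finset.sum_congr rfl fun x _ => ?_
  rw [measure_hitsAt (Finset.mem_coe.2 hy), ← ENNReal.tsum_mul_left, ← ENNReal.tsum_mul_left]
  refine tsum_congr fun n => ?_
  rw [hP.reversal hb]
  ring

end Chain

section Weights

variable {V : Type*} (G : SimpleGraph V) [G.LocallyFinite] {a : V → V → ℝ}

theorem aTot_nonneg (hpos : ∀ x y, G.Adj x y → 0 < a x y) (x : V) : 0 ≤ aTot G a x :=
  Finset.sum_nonneg fun z hz => (hpos x z ((G.mem_neighborFinset x z).1 hz)).le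

theorem aTot_mul_step (hpos : ∀ x y, G.Adj x y → 0 < a x y) {x y : V} (h : G.Adj x y) :
    aTot G a x * step G a x y = a x y := by
  have h0 : 0 < aTot G a x :=
    Finset.sum_pos (fun z hz => hpos x z ((G.mem_neighborFinset x z).1 hz))
      ⟨y, (G.mem_neighborFinset x y).2 h⟩
  rw [step, if_pos h, mul_div_cancel₀ _ h0.ne']

theorem step_reversible (hsymm : ∀ x y, a x y = a y x) (hpos : ∀ x y, G.Adj x y → 0 < a x y)
    (x y : V) : aTot G a x * step G a x y = aTot G a y * step G a y x := by
  by_cases h : G.Adj x y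
  · rw [aTot_mul_step G hpos h, aTot_mul_step G hpos h.symm, hsymm]
  · simp [step, h, mt G.adj_symm h]

variable [MeasurableSpace V] {P : V → Measure (ℕ → V)}

theorem equil_nonneg (hpos : ∀ x y, G.Adj x y → 0 < a x y) (K : Finset V) (x : V) :
    0 ≤ equil G a P K x := by
  unfold equil
  split_ifs
  · exact mul_nonneg (aTot_nonneg G hpos x) ENNReal.toReal_nonneg
  · exact le_rfl

theorem harm_mul_capa (hpos : ∀ x y, G.Adj x y → 0 < a x y) (K : Finset V) (y : V) :
    harm G a P K y * capa G a P K = equil G a P K y := by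
  refine div_mul_cancel_of_imp fun h => ?_
  by_cases hy : y ∈ K
  · exact (Finset.sum_eq_zero_iff_of_nonneg fun x _ => equil_nonneg G hpos K x).1 h y hy
  · simp [equil, hy]

end Weights

open ProbabilityTheory in
open Classical in
/-- For nonempty finite vertex sets `K ⊆ L` and any `y`,
`Σ_{x∈L} harm_L(x) · P_x[τ_K < ∞, X_{τ_K} = y] = harm_K(y) · cap(K)/cap(L)`:
the entrance distribution in `K` of the chain started from `harm_L`, conditioned to hit `K`,
is `harm_K`. -/
theorem harm_entrance_distribution
    {V : Type*} [Countable V] [MeasurableSpace V] [DiscreteMeasurableSpace V]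
    (G : SimpleGraph V) [G.LocallyFinite] (hconn : G.Connected)
    (a : V → V → ℝ)
    (hsymm : ∀ x y, a x y = a y x)
    (hpos : ∀ x y, G.Adj x y → 0 < a x y)
    (P : V → Measure (ℕ → V)) (hprob : ∀ x, IsProbabilityMeasure (P x))
    (hP : ∀ (x : V) (n : ℕ) (c : ℕ → V),
      P x {w | ∀ i ≤ n, w i = c i} =
        (if c 0 = x then 1 else 0) *
          ∏ i ∈ Finset.range n, ENNReal.ofReal (step G a (c i) (c (i + 1))))
    (htrans : ∀ x y : V, ∀ᵐ w ∂ P x, {n : ℕ | w n = y}.Finite)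
    (K L : Finset V) (hK : K.Nonempty) (hKL : K ⊆ L) (y : V) :
    ∑ x ∈ L, harm G a P L x * ((P x) (hitsAt (K : Set V) y)).toReal =
      harm G a P K y * (capa G a P K / capa G a P L) := by
  have hchain : IsChainLaw (fun x y => ENNReal.ofReal (step G a x y)) P :=
    fun x n c => by convert hP x n c using 2; rfl
  have hrev : ∀ x y, ENNReal.ofReal (aTot G a x) * ENNReal.ofReal (step G a x y) =
      ENNReal.ofReal (aTot G a y) * ENNReal.ofReal (step G a y x) := fun x y => by
    rw [← ENNReal.ofReal_mul (aTot_nonneg G hpos x), ← ENNReal.ofReal_mul (aTot_nonneg G hpos y),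
      step_reversible G hsymm hpos]
  have hsweep : ∑ x ∈ L, equil G a P L x * ((P x) (hitsAt (K : Set V) y)).toReal =
      equil G a P K y := by
    by_cases hy : y ∈ K
    · have h := congrArg ENNReal.toReal (hchain.sweeping hrev hKL hy fun x => htrans y x)
      rw [ENNReal.toReal_sum fun x _ => ENNReal.mul_ne_top
        (ENNReal.mul_ne_top ENNReal.ofReal_ne_top (measure_ne_top _ _)) (measure_ne_top _ _)] at h
      simp only [ENNReal.toReal_mul, ENNReal.toReal_ofReal (aTot_nonneg G hpos _)] at h
      rw [equil, if_pos hy, ← h]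
      exact Finset.sum_congr rfl fun x hx => by rw [equil, if_pos hx]
    · have hempty : hitsAt (K : Set V) y = ∅ := by
        refine Set.eq_empty_of_forall_notMem fun w hw => hy ?_
        rw [← hw.2]
        exact Nat.sInf_mem hw.1
      simp [hempty, equil, hy]
  rw [← mul_div_assoc, harm_mul_capa G hpos, ← hsweep, Finset.sum_div]
  exact Finset.sum_congr rfl fun x _ => by rw [harm, div_mul_eq_mul_div]
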